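/- Let C be the generalised Cantor set generated by a sequence (λ_i) with λ_i ∈ (0,1/2). If there exists λ ∈ (0,1) such that λ_i ≤ λ for all i ∈ ℕ, then dim_A C ≤ −log 2/log λ. -/

import Mathlib

open Metric Set Filter
open scoped ENNReal NNReal

namespace Paper

noncomputable def coverNum {X : Type*} [MetricSpace X] (F : Set X) (r : ℝ) : ℝ≥0∞ :=
  ⨅ (s : Finset X) (_ : F ⊆ ⋃ x ∈ s, closedBall x r), (s.card : ℝ≥0∞)

noncomputable def diamCoverNum {X : Type*} [MetricSpace X] (F : Set X) (r : ℝ) : ℝ≥0∞ :=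
  ⨅ (U : Finset (Set X)) (_ : F ⊆ ⋃₀ ↑U)
    (_ : ∀ A ∈ U, EMetric.diam A ≤ ENNReal.ofReal r), (U.card : ℝ≥0∞)

noncomputable def lowerBoxDim {X : Type*} [MetricSpace X] (F : Set X) : ℝ :=
  Filter.liminf (fun r : ℝ => Real.log (coverNum F r).toReal / (-Real.log r))
    (nhdsWithin 0 (Set.Ioi 0))

noncomputable def upperBoxDim {X : Type*} [MetricSpace X] (F : Set X) : ℝ :=
  Filter.limsup (fun r : ℝ => Real.log (coverNum F r).toReal / (-Real.log r))
    (nhdsWithin 0 (Set.Ioi 0))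

def IsHomogeneous {X : Type*} [MetricSpace X] (F : Set X) (s : ℝ) : Prop :=
  ∀ δ₀ : ℝ, 0 < δ₀ → ∃ C : ℝ, 0 < C ∧
    ∀ x ∈ F, ∀ δ ρ : ℝ, 0 < ρ → ρ < δ → δ ≤ δ₀ →
      coverNum (closedBall x δ ∩ F) ρ ≤ ENNReal.ofReal (C * (δ / ρ) ^ s)

noncomputable def assouadDim {X : Type*} [MetricSpace X] (F : Set X) : EReal :=
  sInf ((fun s : ℝ => (s : EReal)) '' {s : ℝ | 0 ≤ s ∧ IsHomogeneous F s})

def EquiHomogeneous {X : Type*} [MetricSpace X] (F : Set X) : Prop :=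
  ∀ δ₀ : ℝ, 0 < δ₀ → ∃ M : ℝ≥0, 1 ≤ M ∧ ∃ c₁ c₂ : ℝ, 0 < c₁ ∧ 0 < c₂ ∧
    ∀ δ ρ : ℝ, 0 < ρ → ρ < δ → δ ≤ δ₀ →
      (⨆ x ∈ F, coverNum (closedBall x δ ∩ F) ρ) ≤
        (M : ℝ≥0∞) * ⨅ x ∈ F, coverNum (closedBall x (c₁ * δ) ∩ F) (c₂ * ρ)

noncomputable def cantorLen (lam : ℕ → ℝ) (n : ℕ) : ℝ := ∏ i ∈ Finset.range n, lam i

noncomputable def cantorPre (lam : ℕ → ℝ) (n : ℕ) : Set ℝ :=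
  ⋃ ε : ℕ → Bool,
    Set.Icc (∑ i ∈ Finset.range n, if ε i then cantorLen lam i - cantorLen lam (i + 1) else 0)
      ((∑ i ∈ Finset.range n, if ε i then cantorLen lam i - cantorLen lam (i + 1) else 0) +
        cantorLen lam n)

noncomputable def cantorSet (lam : ℕ → ℝ) : Set ℝ := ⋂ n : ℕ, cantorPre lam n

open Classical in
noncomputable def lamSeq (q : ℝ) (a : ℕ → ℕ) (i : ℕ) : ℝ :=
  if h : ∃ k : ℕ, i + 1 = ∑ j ∈ Finset.range (k + 1), a (2 * j) then
    q ^ (a (2 * h.choose + 1) + 1)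
  else q

open Classical in
noncomputable def muSeq (q : ℝ) (a : ℕ → ℕ) (i : ℕ) : ℝ :=
  if h : ∃ k : ℕ, i + 1 = a 0 + ∑ j ∈ Finset.range (k + 1), a (2 * j + 1) then
    q ^ (a (2 * h.choose + 2) + 1)
  else q

noncomputable def prodSetL2 (C D : Set ℝ) : Set (WithLp 2 (ℝ × ℝ)) :=
  (WithLp.equiv 2 (ℝ × ℝ)).symm '' (C ×ˢ D)

/-- The left endpoint, after `n` steps, of the interval coded by the word `ε`. -/
noncomputable def cantorLeft (lam : ℕ → ℝ) (ε : ℕ → Bool) (n : ℕ) : ℝ :=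
  ∑ i ∈ Finset.range n, if ε i then cantorLen lam i - cantorLen lam (i + 1) else 0

/-- The left endpoints of the level `n + k` intervals inside a level `n` interval, relative to its
own left endpoint. -/
noncomputable def cantorOffsets (lam : ℕ → ℝ) (n : ℕ) : ℕ → Finset ℝ
  | 0 => {0}
  | k + 1 => cantorOffsets lam n k ∪ (cantorOffsets lam n k).image
      (· + (cantorLen lam (n + k) - cantorLen lam (n + k + 1)))

lemma cantorOffsets_card_le (lam : ℕ → ℝ) (n k : ℕ) : (cantorOffsets lam n k).card ≤ 2 ^ k := by
  induction k with
  | zero => simp [cantorOffsets]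
  | succ k ih =>
    rw [cantorOffsets, pow_succ, mul_two]
    exact (Finset.card_union_le _ _).trans (add_le_add ih (Finset.card_image_le.trans ih))

lemma cantorLeft_succ (lam : ℕ → ℝ) (ε : ℕ → Bool) (n : ℕ) :
    cantorLeft lam ε (n + 1) =
      cantorLeft lam ε n + if ε n then cantorLen lam n - cantorLen lam (n + 1) else 0 :=
  Finset.sum_range_succ _ _

lemma cantorLen_succ (lam : ℕ → ℝ) (n : ℕ) :
    cantorLen lam (n + 1) = cantorLen lam n * lam n :=
  Finset.prod_range_succ _ _

lemma exists_cantorLeft_add (lam : ℕ → ℝ) (ε : ℕ → Bool) (n k : ℕ) :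
    ∃ g ∈ cantorOffsets lam n k, cantorLeft lam ε n + g = cantorLeft lam ε (n + k) := by
  induction k with
  | zero => exact ⟨0, by simp [cantorOffsets]⟩
  | succ k ih =>
    obtain ⟨g, hg, h⟩ := ih
    rw [← add_assoc, cantorLeft_succ, ← h]
    by_cases hε : ε (n + k) = true
    · exact ⟨g + (cantorLen lam (n + k) - cantorLen lam (n + k + 1)),
        Finset.mem_union_right _ (Finset.mem_image_of_mem _ hg), by simp [hε, add_assoc]⟩
    · exact ⟨g, Finset.mem_union_left _ hg, by simp [hε]⟩

lemma cantorLeft_mem_cantorOffsets (lam : ℕ → ℝ) (ε : ℕ → Bool) (n : ℕ) :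
    cantorLeft lam ε n ∈ cantorOffsets lam 0 n := by
  obtain ⟨g, hg, h⟩ := exists_cantorLeft_add lam ε 0 n
  have : g = cantorLeft lam ε n := by simpa [cantorLeft] using h
  exact this ▸ hg

section

variable {lam : ℕ → ℝ}

lemma cantorLen_pos (hlam : ∀ i, lam i ∈ Set.Ioo (0 : ℝ) (1 / 2)) (n : ℕ) :
    0 < cantorLen lam n :=
  Finset.prod_pos fun i _ => (hlam i).1

lemma two_mul_cantorLen_succ_le (hlam : ∀ i, lam i ∈ Set.Ioo (0 : ℝ) (1 / 2)) (n : ℕ) :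
    2 * cantorLen lam (n + 1) ≤ cantorLen lam n := by
  rw [cantorLen_succ]
  nlinarith [cantorLen_pos hlam n, (hlam n).2]

lemma cantorLen_add_le (hlam : ∀ i, lam i ∈ Set.Ioo (0 : ℝ) (1 / 2)) {l : ℝ}
    (hle : ∀ i, lam i ≤ l) (n k : ℕ) :
    cantorLen lam (n + k) ≤ cantorLen lam n * l ^ k := by
  induction k with
  | zero => simp
  | succ k ih =>
    rw [← add_assoc, cantorLen_succ, pow_succ, ← mul_assoc]
    exact mul_le_mul ih (hle _) (hlam _).1.le ((cantorLen_pos hlam _).le.trans ih)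

lemma exists_cantorLen_le (hlam : ∀ i, lam i ∈ Set.Ioo (0 : ℝ) (1 / 2)) {r : ℝ} (hr : 0 < r) :
    ∃ n, cantorLen lam n ≤ r := by
  obtain ⟨n, hn⟩ := exists_pow_lt_of_lt_one hr (by norm_num : (1 / 2 : ℝ) < 1)
  refine ⟨n, le_trans ?_ hn.le⟩
  simpa [cantorLen] using cantorLen_add_le hlam (fun i => (hlam i).2.le) 0 n

lemma cantorLen_le_abs_sub (hlam : ∀ i, lam i ∈ Set.Ioo (0 : ℝ) (1 / 2)) (n : ℕ) :
    ∀ a ∈ cantorOffsets lam 0 n, ∀ b ∈ cantorOffsets lam 0 n, a ≠ b →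
      cantorLen lam n ≤ |a - b| := by
  induction n with
  | zero => simp [cantorOffsets]
  | succ n ih =>
    have h2 := two_mul_cantorLen_succ_le hlam n
    have h0 := cantorLen_pos hlam (n + 1)
    intro a ha b hb hab
    simp only [cantorOffsets, Finset.mem_union, Finset.mem_image, zero_add] at ha hb
    rcases ha with ha | ⟨a, ha, rfl⟩ <;> rcases hb with hb | ⟨b, hb, rfl⟩ <;>
    · by_cases h : a = b
      · subst h
        first
        | exact absurd rfl hab
        | (rw [le_abs']; first | (left; linarith) | (right; linarith))
      · have := ih a ha b hb h
        rw [le_abs'] at this ⊢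
        rcases this with h | h
        · left; linarith
        · right; linarith

lemma mem_Icc_cantorLeft_of_le (hlam : ∀ i, lam i ∈ Set.Ioo (0 : ℝ) (1 / 2)) {ε : ℕ → Bool}
    {y : ℝ} (n k : ℕ)
    (hy : y ∈ Set.Icc (cantorLeft lam ε (n + k))
      (cantorLeft lam ε (n + k) + cantorLen lam (n + k))) :
    y ∈ Set.Icc (cantorLeft lam ε n) (cantorLeft lam ε n + cantorLen lam n) := by
  induction k with
  | zero => simpa using hy
  | succ k ih =>
    refine ih ?_
    have h2 := two_mul_cantorLen_succ_le hlam (n + k)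
    have h0 := cantorLen_pos hlam (n + k + 1)
    rw [← add_assoc, cantorLeft_succ] at hy
    obtain ⟨h3, h4⟩ := hy
    split_ifs at h3 h4 <;> constructor <;> linarith

lemma card_filter_cantorOffsets_le (hlam : ∀ i, lam i ∈ Set.Ioo (0 : ℝ) (1 / 2)) (n : ℕ)
    (x : ℝ) {δ : ℝ} (hδ : δ ≤ cantorLen lam n) :
    ((cantorOffsets lam 0 n).filter
      (fun a => a ∈ Set.Icc (x - δ - cantorLen lam n) (x + δ))).card ≤ 4 := by
  have h0 := cantorLen_pos hlam n
  set c := x - δ - cantorLen lam n with hc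
  have h4 : (Finset.Icc (0 : ℤ) 3).card = 4 := by simp
  rw [← h4]
  refine Finset.card_le_card_of_injOn (fun a => ⌊(a - c) / cantorLen lam n⌋) ?_ ?_
  · intro a ha
    simp only [Finset.coe_filter, Set.mem_ofPred_eq, Set.mem_Icc] at ha
    simp only [Finset.coe_Icc, Set.mem_Icc]
    constructor
    · exact Int.floor_nonneg.2 (div_nonneg (by linarith) h0.le)
    · refine Int.lt_add_one_iff.1 (Int.floor_lt.2 ?_)
      rw [div_lt_iff₀ h0]
      push_cast
      linarith
  · intro a ha b hb hab
    simp only [Finset.coe_filter, Set.mem_ofPred_eq] at ha hb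
    by_contra hne
    have h1 := Int.abs_sub_lt_one_of_floor_eq_floor hab
    rw [← sub_div, abs_div, abs_of_pos h0, div_lt_one h0, sub_sub_sub_cancel_right] at h1
    exact absurd h1 (not_lt.2 (cantorLen_le_abs_sub hlam n a ha.1 b hb.1 hne))

lemma coverNum_closedBall_inter_cantorSet_le (hlam : ∀ i, lam i ∈ Set.Ioo (0 : ℝ) (1 / 2))
    (n k : ℕ) (x : ℝ) {δ ρ : ℝ} (hδ : n = 0 ∨ δ ≤ cantorLen lam n)
    (hρ : cantorLen lam (n + k) ≤ ρ) :
    coverNum (closedBall x δ ∩ cantorSet lam) ρ ≤ ((4 * 2 ^ k : ℕ) : ℝ≥0∞) := by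
  set T := (cantorOffsets lam 0 n).filter
    (fun a => a ∈ Set.Icc (x - δ - cantorLen lam n) (x + δ))
  have hTcard : T.card ≤ 4 := by
    rcases hδ with rfl | hδ
    · refine (Finset.card_filter_le _ _).trans ?_
      simp [cantorOffsets]
    · exact card_filter_cantorOffsets_le hlam n x hδ
  have hcover : closedBall x δ ∩ cantorSet lam ⊆
      ⋃ z ∈ Finset.image₂ (· + ·) T (cantorOffsets lam n k), closedBall z ρ := by
    rintro y ⟨hyx, hyC⟩
    rw [cantorSet, Set.mem_iInter] at hyC
    obtain ⟨ε, hε⟩ := Set.mem_iUnion.1 (hyC (n + k))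
    change y ∈ Set.Icc (cantorLeft lam ε (n + k))
      (cantorLeft lam ε (n + k) + cantorLen lam (n + k)) at hε
    have hn := mem_Icc_cantorLeft_of_le hlam n k hε
    obtain ⟨g, hg, h⟩ := exists_cantorLeft_add lam ε n k
    rw [Real.closedBall_eq_Icc] at hyx
    refine Set.mem_iUnion₂.2 ⟨cantorLeft lam ε (n + k), ?_, ?_⟩
    · rw [← h]
      refine Finset.mem_image₂_of_mem (Finset.mem_filter.2
        ⟨cantorLeft_mem_cantorOffsets lam ε n, ?_, ?_⟩) hg
      · linarith [hyx.1, hn.2]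
      · linarith [hyx.2, hn.1]
    · have := cantorLen_pos hlam (n + k)
      rw [Real.closedBall_eq_Icc]
      exact ⟨by linarith [hε.1], by linarith [hε.2]⟩
  refine (iInf₂_le (Finset.image₂ (· + ·) T (cantorOffsets lam n k)) hcover).trans
    (Nat.cast_le.2 ?_)
  exact (Finset.card_image₂_le _ _ _).trans
    (Nat.mul_le_mul hTcard (cantorOffsets_card_le lam n k))

lemma two_pow_le_rpow_of_cantorLen (hlam : ∀ i, lam i ∈ Set.Ioo (0 : ℝ) (1 / 2)) {l : ℝ}
    (hl : l ∈ Set.Ioo (0 : ℝ) 1) (hle : ∀ i, lam i ≤ l) {δ ρ : ℝ} (hρ : 0 < ρ) {n k : ℕ}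
    (hn : cantorLen lam n ≤ δ) (hk : ρ ≤ cantorLen lam (n + k)) :
    (2 : ℝ) ^ k ≤ (δ / ρ) ^ (-(Real.log 2 / Real.log l)) := by
  have hlog : Real.log l < 0 := Real.log_neg hl.1 hl.2
  have hs : 0 ≤ -(Real.log 2 / Real.log l) :=
    neg_nonneg.2 (div_nonpos_of_nonneg_of_nonpos (Real.log_nonneg (by norm_num)) hlog.le)
  have htwo : (l⁻¹) ^ (-(Real.log 2 / Real.log l)) = 2 := by
    rw [Real.rpow_def_of_pos (inv_pos.2 hl.1), Real.log_inv,
      show -Real.log l * -(Real.log 2 / Real.log l) = Real.log 2 by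
        rw [neg_mul_neg, mul_div_cancel₀ _ hlog.ne],
      Real.exp_log (by norm_num)]
  have hpow : (l⁻¹) ^ k ≤ δ / ρ := by
    have hlk : 0 < l ^ k := pow_pos hl.1 k
    rw [inv_pow, le_div_iff₀ hρ, inv_mul_le_iff₀ hlk]
    calc ρ ≤ cantorLen lam n * l ^ k := hk.trans (cantorLen_add_le hlam hle n k)
      _ ≤ δ * l ^ k := by gcongr
      _ = l ^ k * δ := mul_comm _ _
  calc (2 : ℝ) ^ k = ((l⁻¹) ^ k) ^ (-(Real.log 2 / Real.log l)) := by
        rw [← Real.rpow_pow_comm (inv_pos.2 hl.1).le, htwo]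
    _ ≤ _ := Real.rpow_le_rpow (pow_nonneg (inv_pos.2 hl.1).le k) hpow hs

theorem isHomogeneous_cantorSet (hlam : ∀ i, lam i ∈ Set.Ioo (0 : ℝ) (1 / 2)) {l : ℝ}
    (hl : l ∈ Set.Ioo (0 : ℝ) 1) (hle : ∀ i, lam i ≤ l) :
    IsHomogeneous (cantorSet lam) (-(Real.log 2 / Real.log l)) := by
  classical
  have hlog : Real.log l < 0 := Real.log_neg hl.1 hl.2
  have hs : 0 ≤ -(Real.log 2 / Real.log l) :=
    neg_nonneg.2 (div_nonpos_of_nonneg_of_nonpos (Real.log_nonneg (by norm_num)) hlog.le)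
  refine fun δ₀ _ => ⟨16, by norm_num, fun x _ δ ρ hρ hρδ _ => ?_⟩
  have hδex := exists_cantorLen_le hlam (hρ.trans hρδ)
  have hρex := exists_cantorLen_le hlam hρ
  set n := Nat.find hδex
  set m := Nat.find hρex
  have hnδ : cantorLen lam n ≤ δ := Nat.find_spec hδex
  have hmρ : cantorLen lam m ≤ ρ := Nat.find_spec hρex
  have hnm : n ≤ m := Nat.find_min' hδex (hmρ.trans hρδ.le)
  have hδ : n - 1 = 0 ∨ δ ≤ cantorLen lam (n - 1) := by
    rcases Nat.eq_zero_or_pos n with h | h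
    · left; omega
    · exact .inr (not_le.1 (Nat.find_min hδex (Nat.sub_lt h one_pos))).le
  have hpow : (2 : ℝ) ^ (m - n) ≤ 2 * (δ / ρ) ^ (-(Real.log 2 / Real.log l)) := by
    rcases hnm.eq_or_lt with h | h
    · have : 1 ≤ (δ / ρ) ^ (-(Real.log 2 / Real.log l)) :=
        Real.one_le_rpow ((one_le_div hρ).2 hρδ.le) hs
      rw [← h, Nat.sub_self, pow_zero]
      linarith
    · rw [show m - n = (m - 1 - n) + 1 by omega, pow_succ, mul_comm]
      have hlt : ρ ≤ cantorLen lam (n + (m - 1 - n)) := by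
        rw [show n + (m - 1 - n) = m - 1 by omega]
        exact (not_le.1 (Nat.find_min hρex (Nat.sub_lt (by omega) one_pos))).le
      have := two_pow_le_rpow_of_cantorLen hlam hl hle hρ hnδ hlt
      linarith
  refine (coverNum_closedBall_inter_cantorSet_le hlam (n - 1) (m - (n - 1)) x hδ
    (by rwa [Nat.add_sub_cancel' (by omega)])).trans ?_
  rw [← ENNReal.ofReal_natCast]
  refine ENNReal.ofReal_le_ofReal ?_
  have hstep : (2 : ℝ) ^ (m - (n - 1)) ≤ 2 ^ (m - n + 1) :=
    pow_le_pow_right₀ one_le_two (by omega)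
  rw [pow_succ] at hstep
  push_cast
  linarith

end

theorem statement11 (lam : ℕ → ℝ) (hlam : ∀ i, lam i ∈ Set.Ioo (0 : ℝ) (1 / 2))
    (l : ℝ) (hl : l ∈ Set.Ioo (0 : ℝ) 1) (hle : ∀ i, lam i ≤ l) :
    assouadDim (cantorSet lam) ≤ ((-(Real.log 2 / Real.log l) : ℝ) : EReal) := by
  have hlog : Real.log l < 0 := Real.log_neg hl.1 hl.2
  exact sInf_le ⟨_, ⟨neg_nonneg.2 (div_nonpos_of_nonneg_of_nonpos
    (Real.log_nonneg (by norm_num)) hlog.le), isHomogeneous_cantorSet hlam hl hle⟩, rfl⟩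

end Paper
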